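/- Let M be a finite matroid that is disconnected. Then M is (2,2)-uniform if and only if at least one of the following holds: (i) M or M* is paving; (ii) M is isomorphic to M_p ⊕ U_{0,1} or to M_p* ⊕ U_{1,1} for some paving matroid M_p; (iii) M is isomorphic to M_p ⊕ U_{1,2} for some sparse paving matroid M_p. Here ⊕ denotes direct sum, U_{0,1} is a single loop, U_{1,1} is a single coloop, and U_{1,2} is a rank-1 matroid on two elements. -/

import Mathlib

open Set

namespace Matroid

variable {α β : Type*}

/-- The rank of a set `X` in a matroid `M` : the maximum cardinality of an
independent subset of `X`. -/
noncomputable def rSet (M : Matroid α) (X : Set α) : ℕ :=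
  sSup {n : ℕ | ∃ I, M.Indep I ∧ I ⊆ X ∧ I.ncard = n}

/-- The rank of a matroid. -/
noncomputable def rankM (M : Matroid α) : ℕ := M.rSet M.E

/-- A circuit of `M` : a minimal dependent subset of the ground set. -/
def CircuitM (M : Matroid α) (C : Set α) : Prop :=
  C ⊆ M.E ∧ ¬ M.Indep C ∧ ∀ D, D ⊂ C → M.Indep D

/-- Deletion of a set from a matroid. -/
def deleteS (M : Matroid α) (D : Set α) : Matroid α := M ↾ (M.E \ D)

/-- Contraction of a set in a matroid. -/
def contractS (M : Matroid α) (C : Set α) : Matroid α := (M✶.deleteS C)✶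

/-- `N` is a minor of `M` if it is obtained from `M` by a contraction
followed by a deletion. -/
def IsMinorOf (N M : Matroid α) : Prop :=
  ∃ C D : Set α, C ⊆ M.E ∧ D ⊆ M.E ∧ Disjoint C D ∧ N = (M.contractS C).deleteS D

/-- `M` is isomorphic to `N` : there is a bijection of the ground sets
preserving independence. -/
def IsoTo (M : Matroid α) (N : Matroid β) : Prop :=
  ∃ e : M.E ≃ N.E, ∀ I : Set M.E,
    M.Indep ((↑) '' I) ↔ N.Indep ((↑) '' (e '' I))

/-- The matroid `U_{k,k} ⊕ U_{0,ℓ}` consisting of `k` coloops and `ℓ` loops. -/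
def freeLoopy (k ℓ : ℕ) : Matroid (Fin (k + ℓ)) :=
  uniqueBaseOn {i : Fin (k + ℓ) | (i : ℕ) < k} univ

/-- A matroid is `(k,ℓ)`-uniform if it has no minor isomorphic to `U_{k,k} ⊕ U_{0,ℓ}`. -/
def KLUniform (k ℓ : ℕ) (M : Matroid α) : Prop :=
  ¬ ∃ N : Matroid α, N.IsMinorOf M ∧ N.IsoTo (freeLoopy k ℓ)

/-- A matroid is paving if every circuit has size at least the rank of the matroid. -/
def PavingM (M : Matroid α) : Prop := ∀ C, M.CircuitM C → M.rankM ≤ C.ncard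

/-- A matroid is simple if it has no circuits of size at most two. -/
def SimpleM (M : Matroid α) : Prop := ∀ C, M.CircuitM C → 2 < C.ncard

/-- A matroid is uniform if its independent sets are exactly the subsets of the
ground set of cardinality at most the rank. -/
def UniformM (M : Matroid α) : Prop := ∀ I ⊆ M.E, (M.Indep I ↔ I.ncard ≤ M.rankM)

/-- A matroid is representable over a field `𝔽` if there is a map from its ground type to
an `𝔽`-vector space under which independence coincides with linear independence. -/
def RepOver (𝔽 : Type*) [Field 𝔽] (M : Matroid α) : Prop :=
  ∃ (W : Type) (_ : AddCommGroup W) (_ : Module 𝔽 W) (φ : α → W),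
    ∀ I ⊆ M.E, (M.Indep I ↔ Set.InjOn φ I ∧ LinearIndependent 𝔽 (fun x : I => φ x))


/-- A matroid is connected if its ground set is nonempty and every two distinct elements
of the ground set lie in a common circuit. -/
def ConnectedM (M : Matroid α) : Prop :=
  M.E.Nonempty ∧ ∀ x ∈ M.E, ∀ y ∈ M.E, x ≠ y → ∃ C, M.CircuitM C ∧ x ∈ C ∧ y ∈ C

/-- The uniform matroid `U_{1,2}` : a rank-one matroid on two elements. -/
def U12 : Matroid (Fin 2) := (freeOn (univ : Set (Fin 1))).comap (fun _ => 0)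

/-- There is a set of nullity at least `a` and corank at least `b`. -/
def PP (M : Matroid α) (a b : ℕ) : Prop :=
  ∃ X ⊆ M.E, M.rSet X + a ≤ X.ncard ∧ M.rSet X + b ≤ M.rSet M.E

lemma rSet_eq_toNat (M : Matroid α) (hM : M.Finite) (X : Set α) (hX : X ⊆ M.E) :
    M.rSet X = (M.eRk X).toNat := by
  obtain ⟨I, hI⟩ := M.exists_isBasis X
  rw [hI.eRk_eq_encard]
  refine IsGreatest.csSup_eq ⟨⟨I, hI.indep, hI.subset, rfl⟩, ?_⟩
  rintro n ⟨J, hJ, hJX, rfl⟩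
  have h := hJ.encard_le_eRk_of_subset hJX
  rw [hI.eRk_eq_encard] at h
  have hIf : I.Finite := hM.ground_finite.subset hI.indep.subset_ground
  exact ENat.toNat_le_toNat h hIf.encard_lt_top.ne

lemma cast_rSet (M : Matroid α) (hM : M.Finite) (X : Set α) (hX : X ⊆ M.E) :
    (M.rSet X : ℕ∞) = M.eRk X := by
  rw [rSet_eq_toNat M hM X hX]
  apply ENat.natCast_toNat
  have := M.eRk_le_encard X
  exact (this.trans_lt (hM.ground_finite.subset hX).encard_lt_top).ne

lemma rSet_of_basis (M : Matroid α) (hM : M.Finite) {I X : Set α} (h : M.IsBasis I X) :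
    M.rSet X = I.ncard := by
  rw [rSet_eq_toNat M hM X h.subset_ground, h.eRk_eq_encard]; rfl

lemma rSet_mono (M : Matroid α) (hM : M.Finite) {X Y : Set α} (h : X ⊆ Y) (hY : Y ⊆ M.E) :
    M.rSet X ≤ M.rSet Y := by
  have := M.eRk_mono h
  rw [← cast_rSet M hM X (h.trans hY), ← cast_rSet M hM Y hY] at this
  exact_mod_cast this

lemma indep_le_rSet (M : Matroid α) (hM : M.Finite) {I X : Set α} (hI : M.Indep I) (h : I ⊆ X)
    (hX : X ⊆ M.E) : I.ncard ≤ M.rSet X := by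
  have h2 := rSet_mono M hM h hX
  rwa [rSet_of_basis M hM hI.isBasis_self] at h2

lemma rSet_le_ncard (M : Matroid α) (hM : M.Finite) {X : Set α} (hX : X ⊆ M.E) :
    M.rSet X ≤ X.ncard := by
  obtain ⟨I, hI⟩ := M.exists_isBasis X
  rw [rSet_of_basis M hM hI]
  exact ncard_le_ncard hI.subset (hM.ground_finite.subset hX)

lemma indep_of_rSet (M : Matroid α) (hM : M.Finite) {X : Set α} (hX : X ⊆ M.E)
    (h : X.ncard ≤ M.rSet X) : M.Indep X := by
  obtain ⟨I, hI⟩ := M.exists_isBasis X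
  rw [rSet_of_basis M hM hI] at h
  have := eq_of_subset_of_ncard_le hI.subset h (hM.ground_finite.subset hX)
  exact this ▸ hI.indep

lemma dual_rSet (M : Matroid α) (hM : M.Finite) {X : Set α} (hX : X ⊆ M.E) :
    M✶.rSet X + M.rSet M.E = M.rSet (M.E \ X) + X.ncard := by
  have h := M.eRk_dual_add_eRank X hX
  have hM' : M✶.Finite := ⟨hM.ground_finite⟩
  rw [← M.eRk_ground, ← cast_rSet M✶ hM' X hX, ← cast_rSet M hM _ Subset.rfl,
    ← cast_rSet M hM _ sdiff_subset,
    ← (hM.ground_finite.subset hX).cast_ncard_eq] at h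
  exact_mod_cast h

lemma ncard_compl (M : Matroid α) (hM : M.Finite) {X : Set α} (hX : X ⊆ M.E) :
    (M.E \ X).ncard + X.ncard = M.E.ncard :=
  ncard_sdiff_add_ncard_of_subset hX hM.ground_finite

lemma PP_dual_aux (M : Matroid α) (hM : M.Finite) {a b : ℕ} (h : M✶.PP a b) : M.PP b a := by
  obtain ⟨X, hX, h1, h2⟩ := h
  change X ⊆ M.E at hX
  change M✶.rSet X + b ≤ M✶.rSet M.E at h2
  have d1 := dual_rSet M hM hX
  have d2 := dual_rSet M hM (Subset.refl M.E)
  have h0 : M.rSet (M.E \ M.E) = 0 := by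
    have := rSet_le_ncard M hM (X := M.E \ M.E) sdiff_subset
    simpa using this
  have := ncard_compl M hM hX
  refine ⟨M.E \ X, sdiff_subset, ?_, ?_⟩ <;> omega

lemma PP_dual (M : Matroid α) (hM : M.Finite) {a b : ℕ} : M✶.PP a b ↔ M.PP b a := by
  refine ⟨PP_dual_aux M hM, fun h => ?_⟩
  apply PP_dual_aux M✶ ⟨hM.ground_finite⟩
  rwa [dual_dual]

lemma circuitM_iff (M : Matroid α) (C : Set α) : M.CircuitM C ↔ M.IsCircuit C := by
  rw [isCircuit_iff_forall_ssubset]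
  constructor
  · rintro ⟨h1, h2, h3⟩
    exact ⟨⟨h2, h1⟩, fun I hI => h3 I hI⟩
  · rintro ⟨h1, h2⟩
    exact ⟨h1.2, h1.1, fun D hD => h2 hD⟩

lemma circuit_rSet (M : Matroid α) (hM : M.Finite) {C : Set α} (hC : M.IsCircuit C) :
    M.rSet C + 1 = C.ncard := by
  have h := hC.eRk_add_one_eq
  rw [← cast_rSet M hM C hC.subset_ground,
    ← (hM.ground_finite.subset hC.subset_ground).cast_ncard_eq] at h
  exact_mod_cast h

lemma paving_iff (M : Matroid α) (hM : M.Finite) : M.PavingM ↔ ¬ M.PP 1 2 := by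
  constructor
  · rintro h ⟨X, hX, h1, h2⟩
    have hd : M.Dep X := by
      refine ⟨fun hi => ?_, hX⟩
      have := indep_le_rSet M hM hi Subset.rfl hX
      omega
    obtain ⟨C, hCX, hC⟩ := hd.exists_isCircuit_subset
    have h3 := h C ((circuitM_iff _ _).2 hC)
    have h4 := circuit_rSet M hM hC
    have h5 := rSet_mono M hM hCX hX
    unfold rankM at h3
    omega
  · intro h C hC
    rw [circuitM_iff] at hC
    have h4 := circuit_rSet M hM hC
    by_contra hlt
    unfold rankM at hlt
    exact h ⟨C, hC.subset_ground, by omega, by omega⟩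

lemma paving_dual_iff (M : Matroid α) (hM : M.Finite) : M✶.PavingM ↔ ¬ M.PP 2 1 := by
  rw [paving_iff M✶ ⟨hM.ground_finite⟩, PP_dual M hM]

/-- `A` is a separator of `M`. -/
def Sep (M : Matroid α) (A : Set α) : Prop :=
  A ⊆ M.E ∧ ∀ I ⊆ M.E, M.Indep (I ∩ A) → M.Indep (I \ A) → M.Indep I

lemma Sep.compl {M : Matroid α} {A : Set α} (h : M.Sep A) : M.Sep (M.E \ A) := by
  refine ⟨sdiff_subset, fun I hI h1 h2 => h.2 I hI (h2.subset ?_) (h1.subset ?_)⟩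
  · intro x hx; exact ⟨hx.1, fun h => h.2 hx.2⟩
  · intro x hx; exact ⟨hx.1, hI hx.1, hx.2⟩

lemma ncard_split (M : Matroid α) (hM : M.Finite) (A : Set α) {X : Set α} (hX : X ⊆ M.E) :
    X.ncard = (X ∩ A).ncard + (X \ A).ncard :=
  (ncard_inter_add_ncard_sdiff_eq_ncard X A (hM.ground_finite.subset hX)).symm

lemma Sep.rSet {M : Matroid α} (hM : M.Finite) {A : Set α} (h : M.Sep A) {X : Set α}
    (hX : X ⊆ M.E) : M.rSet X = M.rSet (X ∩ A) + M.rSet (X \ A) := by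
  apply le_antisymm
  · obtain ⟨I, hI⟩ := M.exists_isBasis X
    rw [rSet_of_basis M hM hI, ncard_split M hM A hI.indep.subset_ground]
    apply add_le_add
    · exact indep_le_rSet M hM (hI.indep.subset inter_subset_left)
        (inter_subset_inter_left A hI.subset) (inter_subset_left.trans hX)
    · exact indep_le_rSet M hM (hI.indep.subset sdiff_subset)
        (sdiff_subset_sdiff_left hI.subset) (sdiff_subset.trans hX)
  · obtain ⟨I, hI⟩ := M.exists_isBasis (X ∩ A) (inter_subset_left.trans hX)
    obtain ⟨J, hJ⟩ := M.exists_isBasis (X \ A) (sdiff_subset.trans hX)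
    rw [rSet_of_basis M hM hI, rSet_of_basis M hM hJ]
    have hIA : I ⊆ A := hI.subset.trans inter_subset_right
    have hJA : ∀ x ∈ J, x ∉ A := fun x hx => (hJ.subset hx).2
    have hsub : I ∪ J ⊆ X :=
      union_subset (hI.subset.trans inter_subset_left) (hJ.subset.trans sdiff_subset)
    have e1 : (I ∪ J) ∩ A = I := by
      ext x; constructor
      · rintro ⟨h | h, h'⟩
        · exact h
        · exact absurd h' (hJA x h)
      · intro hx; exact ⟨Or.inl hx, hIA hx⟩
    have e2 : (I ∪ J) \ A = J := by
      ext x; constructor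
      · rintro ⟨h | h, h'⟩
        · exact absurd (hIA h) h'
        · exact h
      · intro hx; exact ⟨Or.inr hx, hJA x hx⟩
    have hind : M.Indep (I ∪ J) := by
      apply h.2 _ (hsub.trans hX)
      · rw [e1]; exact hI.indep
      · rw [e2]; exact hJ.indep
    have h3 := indep_le_rSet M hM hind hsub hX
    rw [ncard_split M hM A hind.subset_ground, e1, e2] at h3
    exact h3

lemma restrict_rSet (M : Matroid α) {A X : Set α} (h : X ⊆ A) : (M ↾ A).rSet X = M.rSet X := by
  unfold Matroid.rSet
  congr 1
  ext n
  constructor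
  · rintro ⟨I, h1, h2, h3⟩
    exact ⟨I, (restrict_indep_iff.1 h1).1, h2, h3⟩
  · rintro ⟨I, h1, h2, h3⟩
    exact ⟨I, restrict_indep_iff.2 ⟨h1, h2.trans h⟩, h2, h3⟩

lemma circuit_trans (M : Matroid α) (hM : M.Finite) {x z : α} : ∀ (n : ℕ) (C₁ C₂ : Set α),
    M.IsCircuit C₁ → M.IsCircuit C₂ → x ∈ C₁ → z ∈ C₂ → (C₁ ∩ C₂).Nonempty →
    (C₁ ∪ C₂).ncard = n → ∃ C, M.IsCircuit C ∧ x ∈ C ∧ z ∈ C := by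
  intro n
  induction n using Nat.strong_induction_on with
  | _ n ih =>
    intro C₁ C₂ h1 h2 hx hz ⟨e, he1, he2⟩ hn
    have key : ∀ C D, M.IsCircuit C → M.IsCircuit D → x ∈ C → z ∈ D → (C ∩ D).Nonempty →
        C ∪ D ⊆ C₁ ∪ C₂ → (∃ C, M.IsCircuit C ∧ x ∈ C ∧ z ∈ C) ∨ C₁ ∪ C₂ ⊆ C ∪ D := by
      intro C D hC hD hxC hzD hCD hsub
      by_cases hs : C₁ ∪ C₂ ⊆ C ∪ D
      · exact Or.inr hs
      · left
        have hlt : (C ∪ D).ncard < (C₁ ∪ C₂).ncard :=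
          ncard_lt_ncard ⟨hsub, hs⟩ (hM.ground_finite.subset
            (union_subset h1.subset_ground h2.subset_ground))
        exact ih _ (hn ▸ hlt) C D hC hD hxC hzD hCD rfl
    by_contra hcon
    have hxC2 : x ∉ C₂ := fun h => hcon ⟨C₂, h2, h, hz⟩
    have hzC1 : z ∉ C₁ := fun h => hcon ⟨C₁, h1, hx, h⟩
    obtain ⟨C₃, hs3, h3, hx3⟩ := h1.strong_elimination h2 he1 he2 hx hxC2
    obtain ⟨C₄, hs4, h4, hz4⟩ := h2.strong_elimination h1 he2 he1 hz hzC1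
    -- both new circuits leave the circuit they started from
    have n3 : ∃ y ∈ C₃, y ∈ C₂ ∧ y ∉ C₁ := by
      by_contra hno
      have hsub : C₃ ⊆ C₁ := by
        intro y hy
        by_contra hy1
        exact hno ⟨y, hy, (hs3 hy).1.resolve_left hy1, hy1⟩
      have := h3.eq_of_subset_isCircuit h1 hsub
      exact (hs3 (this ▸ he1)).2 rfl
    have n4 : ∃ y ∈ C₄, y ∈ C₁ ∧ y ∉ C₂ := by
      by_contra hno
      have hsub : C₄ ⊆ C₂ := by
        intro y hy
        by_contra hy1
        exact hno ⟨y, hy, (hs4 hy).1.resolve_left hy1, hy1⟩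
      have := h4.eq_of_subset_isCircuit h2 hsub
      exact (hs4 (this ▸ he2)).2 rfl
    obtain ⟨y, hy3, hy2, hy1⟩ := n3
    obtain ⟨w, hw4, hw1, hw2⟩ := n4
    have k1 := (key C₁ C₄ h1 h4 hx hz4 ⟨w, hw1, hw4⟩ (union_subset subset_union_left
      (fun a ha => (hs4 ha).1.symm))).resolve_left hcon
    have hy4 : y ∈ C₄ := (k1 (Or.inr hy2)).resolve_left hy1
    have k2 := (key C₃ C₄ h3 h4 hx3 hz4 ⟨y, hy3, hy4⟩ (union_subset
      (fun a ha => (hs3 ha).1) (fun a ha => (hs4 ha).1.symm))).resolve_left hcon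
    rcases k2 (Or.inl he1) with h | h
    · exact (hs3 h).2 rfl
    · exact (hs4 h).2 rfl

lemma exists_sep (M : Matroid α) (hM : M.Finite) {x y : α} (hx : x ∈ M.E) (hxy : x ≠ y)
    (h : ¬ ∃ C, M.CircuitM C ∧ x ∈ C ∧ y ∈ C) : ∃ A, M.Sep A ∧ x ∈ A ∧ y ∉ A := by
  refine ⟨{z | z = x ∨ ∃ C, M.IsCircuit C ∧ x ∈ C ∧ z ∈ C}, ⟨?_, ?_⟩, Or.inl rfl, ?_⟩
  · rintro z (rfl | ⟨C, hC, -, hz⟩)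
    · exact hx
    · exact hC.subset_ground hz
  · intro I hI h1 h2
    by_contra hd
    obtain ⟨C, hCI, hC⟩ := (show M.Dep I from ⟨hd, hI⟩).exists_isCircuit_subset
    by_cases hm : ∃ z ∈ C, z = x ∨ ∃ C, M.IsCircuit C ∧ x ∈ C ∧ z ∈ C
    · obtain ⟨z, hzC, hz⟩ := hm
      apply hC.dep.not_indep
      refine h1.subset fun w hw => ⟨hCI hw, ?_⟩
      rcases hz with rfl | ⟨D, hD, hxD, hzD⟩
      · exact Or.inr ⟨C, hC, hzC, hw⟩
      · exact Or.inr (circuit_trans M hM _ D C hD hC hxD hw ⟨z, hzD, hzC⟩ rfl)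
    · apply hC.dep.not_indep
      exact h2.subset fun w hw => ⟨hCI hw, fun hw' => hm ⟨w, hw, hw'⟩⟩
  · rintro (rfl | ⟨C, hC, h1, h2⟩)
    · exact hxy rfl
    · exact h ⟨C, (circuitM_iff _ _).2 hC, h1, h2⟩

lemma isoTo_of (M : Matroid α) (N : Matroid β) (f : α → β) (hf : InjOn f M.E)
    (him : f '' M.E = N.E) (h : ∀ I ⊆ M.E, (M.Indep I ↔ N.Indep (f '' I))) : M.IsoTo N := by
  have hb : BijOn f M.E N.E := him ▸ hf.bijOn_image
  refine ⟨hb.equiv f, fun I => ?_⟩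
  rw [h _ (by rintro _ ⟨x, -, rfl⟩; exact x.2)]
  have : (Subtype.val '' ((hb.equiv f) '' I) : Set β) = f '' (Subtype.val '' I) := by
    rw [image_image, image_image]; rfl
  rw [this]

lemma iso_rSet (M : Matroid α) (N : Matroid β) (e : M.E ≃ N.E)
    (h : ∀ I : Set M.E, M.Indep ((↑) '' I) ↔ N.Indep ((↑) '' (e '' I))) (X : Set M.E) :
    N.rSet ((↑) '' (e '' X)) = M.rSet ((↑) '' X) := by
  unfold rSet
  congr 1
  ext n
  constructor
  · rintro ⟨J, hJ, hJX, rfl⟩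
    obtain ⟨J', hJ', rfl⟩ := subset_image_iff.1 hJX
    obtain ⟨I, hI, rfl⟩ := subset_image_iff.1 hJ'
    refine ⟨_, (h I).2 hJ, image_mono hI, ?_⟩
    rw [ncard_image_of_injective _ Subtype.val_injective,
      ncard_image_of_injective _ Subtype.val_injective, ncard_image_of_injective _ e.injective]
  · rintro ⟨J, hJ, hJX, rfl⟩
    obtain ⟨I, hI, rfl⟩ := subset_image_iff.1 hJX
    refine ⟨_, (h I).1 hJ, image_mono (image_mono hI), ?_⟩
    rw [ncard_image_of_injective _ Subtype.val_injective,
      ncard_image_of_injective _ Subtype.val_injective, ncard_image_of_injective _ e.injective]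

lemma iso_PP (M : Matroid α) (N : Matroid β) (h : M.IsoTo N) {a b : ℕ} (hP : M.PP a b) :
    N.PP a b := by
  obtain ⟨e, h⟩ := h
  obtain ⟨X, hX, h1, h2⟩ := hP
  obtain ⟨X, rfl⟩ : ∃ X' : Set M.E, (↑) '' X' = X :=
    ⟨(↑) ⁻¹' X, by simpa using hX⟩
  have hE : (Subtype.val '' (e '' univ) : Set β) = N.E := by
    simp
  have hr := iso_rSet M N e h univ
  rw [hE] at hr
  simp only [image_univ, Subtype.range_coe_subtype, ofPred_mem_eq] at hr
  refine ⟨(↑) '' (e '' X), by rintro _ ⟨x, -, rfl⟩; exact x.2, ?_, ?_⟩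
  · rw [iso_rSet M N e h, ncard_image_of_injective _ Subtype.val_injective,
      ncard_image_of_injective _ e.injective]
    rwa [ncard_image_of_injective _ Subtype.val_injective] at h1
  · rw [iso_rSet M N e h, hr]; exact h2

lemma sum_finite (M : Matroid α) (N : Matroid β) (hM : M.Finite) (hN : N.Finite) :
    (M.sum N).Finite := by
  constructor
  rw [sum_ground]
  exact (hM.ground_finite.image _).union (hN.ground_finite.image _)

lemma sum_ncard (Y : Set (α ⊕ β)) (hY : Y.Finite) :
    Y.ncard = (Sum.inl ⁻¹' Y).ncard + (Sum.inr ⁻¹' Y).ncard := by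
  have : Y = Sum.inl '' (Sum.inl ⁻¹' Y) ∪ Sum.inr '' (Sum.inr ⁻¹' Y) := by
    ext (x | x) <;> simp
  conv_lhs => rw [this]
  rw [ncard_union_eq ?_ ((hY.preimage Sum.inl_injective.injOn).image _)
    ((hY.preimage Sum.inr_injective.injOn).image _), ncard_image_of_injective _ Sum.inl_injective,
    ncard_image_of_injective _ Sum.inr_injective]
  rw [Set.disjoint_left]; rintro _ ⟨x, -, rfl⟩ ⟨y, -, h⟩; simp at h

lemma sum_rSet (M : Matroid α) (N : Matroid β) (hM : M.Finite) (hN : N.Finite)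
    (Y : Set (α ⊕ β)) (hY : Y ⊆ (M.sum N).E) :
    (M.sum N).rSet Y = M.rSet (Sum.inl ⁻¹' Y) + N.rSet (Sum.inr ⁻¹' Y) := by
  obtain ⟨I, hI⟩ := (M.sum N).exists_isBasis Y hY
  have hS := sum_finite M N hM hN
  rw [rSet_of_basis _ hS hI]
  have h := sum_isBasis_iff.1 hI
  rw [rSet_of_basis _ hM h.1, rSet_of_basis _ hN h.2]
  exact sum_ncard I (hS.ground_finite.subset hI.indep.subset_ground)

/-- Unpacks a bad set in a direct sum. -/
lemma sum_PP (M : Matroid α) (N : Matroid β) (hM : M.Finite) (hN : N.Finite) {a b : ℕ}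
    (h : (M.sum N).PP a b) : ∃ X ⊆ M.E, ∃ Z ⊆ N.E,
      M.rSet X + N.rSet Z + a ≤ X.ncard + Z.ncard ∧
      M.rSet X + N.rSet Z + b ≤ M.rSet M.E + N.rSet N.E := by
  obtain ⟨Y, hY, h1, h2⟩ := h
  have hS := sum_finite M N hM hN
  rw [sum_rSet _ _ hM hN _ hY] at h1 h2
  rw [sum_rSet _ _ hM hN _ Subset.rfl] at h2
  rw [sum_ncard Y (hS.ground_finite.subset hY)] at h1
  have e1 : Sum.inl ⁻¹' (M.sum N).E = M.E := by ext; simp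
  have e2 : Sum.inr ⁻¹' (M.sum N).E = N.E := by ext; simp
  rw [e1, e2] at h2
  exact ⟨_, (preimage_mono hY).trans e1.le, _, (preimage_mono hY).trans e2.le, h1, h2⟩

lemma KL_of_PP (M : Matroid α) (hM : M.Finite) (h : M.PP 2 2) : ¬ M.KLUniform 2 2 := by
  rw [KLUniform, not_not]
  obtain ⟨X, hX, h1, h2⟩ := h
  obtain ⟨I, hI⟩ := M.exists_isBasis X
  obtain ⟨B, hB, hIB⟩ := hI.indep.exists_isBase_superset
  have hXf := hM.ground_finite.subset hX
  have hBf := hM.ground_finite.subset hB.subset_ground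
  rw [rSet_of_basis M hM hI] at h1 h2
  rw [rSet_of_basis M hM hB.isBasis_ground] at h2
  have c1 := ncard_sdiff_add_ncard_of_subset hI.subset hXf
  have c2 := ncard_sdiff_add_ncard_of_subset hIB hBf
  obtain ⟨a, ha, b, hb, hab⟩ := (one_lt_ncard (hBf.subset sdiff_subset)).1
    (show 1 < (B \ I).ncard by omega)
  obtain ⟨c, hc, d, hd, hcd⟩ := (one_lt_ncard (hXf.subset sdiff_subset)).1
    (show 1 < (X \ I).ncard by omega)
  have hcB : ∀ c ∈ X \ I, ¬ M.Indep (insert c I) := by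
    intro c hc hi
    exact hc.2 (hI.mem_of_insert_indep hc.1 hi)
  have hXB : ∀ c ∈ X \ I, c ∉ B := by
    intro c hc hcB'
    exact hcB c hc (hB.indep.subset (insert_subset hcB' hIB))
  have hac : a ≠ c := fun h => hXB c hc (h ▸ ha.1)
  have had : a ≠ d := fun h => hXB d hd (h ▸ ha.1)
  have hbc : b ≠ c := fun h => hXB c hc (h ▸ hb.1)
  have hbd : b ≠ d := fun h => hXB d hd (h ▸ hb.1)
  have hIE := hI.indep.subset_ground
  set S : Set α := {a, b, c, d} with hS
  have hSE : S ⊆ M.E := by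
    rintro x (rfl | rfl | rfl | rfl)
    · exact hB.subset_ground ha.1
    · exact hB.subset_ground hb.1
    · exact hX hc.1
    · exact hX hd.1
  have hSI : ∀ x ∈ S, x ∉ I := by
    rintro x (rfl | rfl | rfl | rfl)
    exacts [ha.2, hb.2, hc.2, hd.2]
  have hNE : ((M.contractS I).deleteS (M.E \ (I ∪ S))).E = S := by
    change (M.E \ I) \ (M.E \ (I ∪ S)) = S
    ext x
    constructor
    · rintro ⟨⟨hxE, hxI⟩, hx⟩
      by_contra hxS
      exact hx ⟨hxE, fun h => h.elim hxI hxS⟩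
    · intro hx
      exact ⟨⟨hSE hx, hSI x hx⟩, fun h => h.2 (Or.inr hx)⟩
  have hNI : ∀ J ⊆ S, (((M.contractS I).deleteS (M.E \ (I ∪ S))).Indep J ↔ J ⊆ {a, b}) := by
    intro J hJ
    have : ((M.contractS I).deleteS (M.E \ (I ∪ S))).Indep J ↔ (M ／ I).Indep J ∧
      J ⊆ ((M.contractS I).deleteS (M.E \ (I ∪ S))).E := restrict_indep_iff
    rw [this, hNE, hI.indep.contract_indep_iff]
    constructor
    · rintro ⟨⟨-, hi⟩, -⟩ x hx
      rcases hJ hx with rfl | rfl | rfl | rfl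
      · simp
      · simp
      · exact absurd (hi.subset (insert_subset (Or.inl hx) subset_union_right)) (hcB _ hc)
      · exact absurd (hi.subset (insert_subset (Or.inl hx) subset_union_right)) (hcB _ hd)
    · intro hJ'
      refine ⟨⟨?_, hB.indep.subset (union_subset ?_ hIB)⟩, hJ⟩
      · rw [Set.disjoint_left]; exact fun x hx => hSI x (hJ hx)
      · intro x hx
        rcases hJ' hx with rfl | rfl
        exacts [ha.1, hb.1]
  refine ⟨_, ⟨I, M.E \ (I ∪ S), hIE, sdiff_subset, ?_, rfl⟩, ?_⟩
  · rw [Set.disjoint_left]; exact fun x hx h => h.2 (Or.inl hx)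
  · classical
    let f : α → Fin (2 + 2) := fun x =>
      if x = a then 0 else if x = b then 1 else if x = c then 2 else 3
    have fa : f a = 0 := by simp [f]
    have fb : f b = 1 := by simp [f, hab.symm]
    have fc : f c = 2 := by simp [f, hac.symm, hbc.symm]
    have fd : f d = 3 := by simp [f, had.symm, hbd.symm, hcd.symm]
    apply isoTo_of _ _ f
    · rw [hNE]
      rintro x (rfl | rfl | rfl | rfl) y (rfl | rfl | rfl | rfl) hxy <;>
        first | rfl | (exfalso; revert hxy; simp only [fa, fb, fc, fd]; decide)
    · rw [hNE]
      change f '' S = univ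
      rw [hS, image_insert_eq, image_insert_eq, image_insert_eq, image_singleton, fa, fb, fc, fd]
      ext i; revert i; decide
    · rw [hNE]
      intro J hJ
      rw [hNI J hJ, freeLoopy, uniqueBaseOn_indep_iff (subset_univ _)]
      constructor
      · rintro h _ ⟨x, hx, rfl⟩
        rcases h hx with rfl | rfl
        · simp [fa]
        · simp [fb]
      · intro h x hx
        have hfx := h (mem_image_of_mem f hx)
        rcases hJ hx with rfl | rfl | rfl | rfl
        · simp
        · simp
        · rw [fc] at hfx; exact absurd hfx (by decide)
        · rw [fd] at hfx; exact absurd hfx (by decide)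

lemma PP_of_not_KL (M : Matroid α) (hM : M.Finite) (h : ¬ M.KLUniform 2 2) : M.PP 2 2 := by
  rw [KLUniform, not_not] at h
  obtain ⟨N, ⟨C, D, hC, hD, hCD, hN⟩, e, he⟩ := h
  have hNE : N.E = (M.E \ C) \ D := by rw [hN]; rfl
  let p : Fin (2 + 2) → α := fun i => (e.symm ⟨i, mem_univ i⟩ : N.E)
  have hpN : ∀ i, p i ∈ N.E := fun i => (e.symm ⟨i, mem_univ i⟩).2
  have hpE : ∀ i, p i ∈ M.E := fun i => (hNE.le (hpN i)).1.1
  have hpC : ∀ i, p i ∉ C := fun i => (hNE.le (hpN i)).1.2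
  have hpinj : Function.Injective p := by
    intro i j hij
    have := e.symm.injective (Subtype.ext hij)
    exact congrArg Subtype.val this
  have hind : ∀ S : Set (Fin (2 + 2)), N.Indep (p '' S) ↔ S ⊆ {i | (i : ℕ) < 2} := by
    intro S
    have h1 := he (e.symm '' (Subtype.val ⁻¹' S))
    have e1 : (Subtype.val '' (e.symm '' (Subtype.val ⁻¹' S)) : Set α) = p '' S := by
      ext x; constructor
      · rintro ⟨_, ⟨y, hy, rfl⟩, rfl⟩
        exact ⟨y, hy, rfl⟩
      · rintro ⟨i, hi, rfl⟩
        exact ⟨_, ⟨⟨i, mem_univ i⟩, hi, rfl⟩, rfl⟩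
    have e2 : (Subtype.val '' (e '' (e.symm '' (Subtype.val ⁻¹' S))) : Set (Fin (2 + 2))) = S := by
      rw [Equiv.image_symm_image]
      ext x; constructor
      · rintro ⟨y, hy, rfl⟩; exact hy
      · intro hx; exact ⟨⟨x, mem_univ x⟩, hx, rfl⟩
    rw [e1, e2, freeLoopy, uniqueBaseOn_indep_iff (subset_univ _)] at h1
    exact h1
  have hNi : ∀ J, N.Indep J ↔ (M ／ C).Indep J ∧ J ⊆ N.E := fun J => by
    rw [hNE, hN]; exact restrict_indep_iff
  have h01 : (M ／ C).Indep {p 0, p 1} := by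
    have := (hind {0, 1}).2 (by rintro x (rfl | rfl) <;> decide)
    rw [image_pair] at this
    exact ((hNi _).1 this).1
  have hloop : ∀ i : Fin (2 + 2), ¬ (i : ℕ) < 2 → p i ∈ M.closure C := by
    intro i hi
    have h1 : ¬ N.Indep {p i} := by
      rw [← image_singleton, hind]
      intro h; exact hi (h rfl)
    have h2 : ¬ (M ／ C).Indep {p i} := fun h => h1 ((hNi _).2 ⟨h, by simpa using hpN i⟩)
    have h3 : (M ／ C).IsLoop (p i) := by
      rw [← singleton_dep]
      exact ⟨h2, by simpa using ⟨hpE i, hpC i⟩⟩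
    exact (contract_isLoop_iff_mem_closure.1 h3).1
  obtain ⟨I, hI⟩ := M.exists_isBasis C
  have hIf := hM.ground_finite.subset hI.indep.subset_ground
  have hCf := hM.ground_finite.subset hC
  have hsub : C ∪ {p 2, p 3} ⊆ M.E :=
    union_subset hC (by rintro x (rfl | rfl); exacts [hpE _, hpE _])
  have hr : M.rSet (C ∪ {p 2, p 3}) ≤ I.ncard := by
    rw [← rSet_of_basis M hM hI]
    have h1 : M.eRk (C ∪ {p 2, p 3}) ≤ M.eRk (M.closure C) := by
      apply M.eRk_mono
      apply union_subset (M.subset_closure C)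
      rintro x (rfl | rfl)
      · exact hloop 2 (by decide)
      · exact hloop 3 (by decide)
    rw [eRk_closure_eq, ← cast_rSet M hM _ hsub, ← cast_rSet M hM _ hC] at h1
    exact_mod_cast h1
  have hne : ∀ i j, i ≠ j → p i ≠ p j := fun i j h h' => h (hpinj h')
  have hIC := ncard_le_ncard hI.subset hCf
  refine ⟨C ∪ {p 2, p 3}, hsub, ?_, ?_⟩
  · rw [ncard_union_eq _ hCf (by simp), ncard_pair (hne _ _ (by decide))]
    · omega
    · rw [Set.disjoint_right]
      rintro x (rfl | rfl); exacts [hpC _, hpC _]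
  · have h2 := (hI.contract_indep_iff.1 h01).1
    have h3 := indep_le_rSet M hM h2 h2.subset_ground Subset.rfl
    rw [ncard_union_eq _ (by simp) hIf, ncard_pair (hne _ _ (by decide))] at h3
    · omega
    · rw [Set.disjoint_left]
      rintro x (rfl | rfl) hx; exacts [hpC _ (hI.subset hx), hpC _ (hI.subset hx)]

lemma KL_iff (M : Matroid α) (hM : M.Finite) : M.KLUniform 2 2 ↔ ¬ M.PP 2 2 :=
  ⟨fun h h' => KL_of_PP M hM h' h, fun h => by_contra fun h' => h (PP_of_not_KL M hM h')⟩

lemma iso_sum {γ : Type*} (M : Matroid α) {A : Set α} (hA : M.Sep A) (L : Matroid γ) (g : α → γ)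
    (hg : InjOn g (M.E \ A)) (him : g '' (M.E \ A) = L.E)
    (hL : ∀ J ⊆ M.E \ A, (M.Indep J ↔ L.Indep (g '' J))) : M.IsoTo ((M ↾ A).sum L) := by
  classical
  let f : α → α ⊕ γ := fun x => if x ∈ A then Sum.inl x else Sum.inr (g x)
  have f1 : ∀ x ∈ A, f x = Sum.inl x := fun x hx => by simp [f, hx]
  have f2 : ∀ x, x ∉ A → f x = Sum.inr (g x) := fun x hx => by simp [f, hx]
  have i1 : ∀ I, Sum.inl ⁻¹' (f '' I) = I ∩ A := by
    intro I; ext x; constructor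
    · rintro ⟨y, hy, h⟩
      by_cases hyA : y ∈ A
      · rw [f1 y hyA] at h
        obtain rfl := Sum.inl_injective h
        exact ⟨hy, hyA⟩
      · rw [f2 y hyA] at h; simp at h
    · rintro ⟨hx, hxA⟩
      exact ⟨x, hx, f1 x hxA⟩
  have i2 : ∀ I, Sum.inr ⁻¹' (f '' I) = g '' (I \ A) := by
    intro I; ext x; constructor
    · rintro ⟨y, hy, h⟩
      by_cases hyA : y ∈ A
      · rw [f1 y hyA] at h; simp at h
      · rw [f2 y hyA] at h
        exact ⟨y, ⟨hy, hyA⟩, Sum.inr_injective h⟩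
    · rintro ⟨y, ⟨hy, hyA⟩, rfl⟩
      exact ⟨y, hy, f2 y hyA⟩
  apply isoTo_of _ _ f
  · intro x hx y hy h
    by_cases hxA : x ∈ A <;> by_cases hyA : y ∈ A
    · rw [f1 x hxA, f1 y hyA] at h; exact Sum.inl_injective h
    · rw [f1 x hxA, f2 y hyA] at h; simp at h
    · rw [f2 x hxA, f1 y hyA] at h; simp at h
    · rw [f2 x hxA, f2 y hyA] at h
      exact hg ⟨hx, hxA⟩ ⟨hy, hyA⟩ (Sum.inr_injective h)
  · have hEA : M.E ∩ A = A := inter_eq_self_of_subset_right hA.1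
    ext (x | x)
    · rw [← mem_preimage, i1, hEA]; simp
    · rw [← mem_preimage, i2, him]; simp
  · intro I hI
    rw [sum_indep_iff, i1, i2, ← hL _ (sdiff_subset_sdiff_left hI), restrict_indep_iff]
    constructor
    · intro h
      exact ⟨⟨h.subset inter_subset_left, inter_subset_right⟩, h.subset sdiff_subset⟩
    · rintro ⟨⟨h1, -⟩, h2⟩
      exact hA.2 I hI h1 h2

lemma restrict_PP (M : Matroid α) {A : Set α} {a b : ℕ} (h : (M ↾ A).PP a b) :
    ∃ X ⊆ A, M.rSet X + a ≤ X.ncard ∧ M.rSet X + b ≤ M.rSet A := by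
  obtain ⟨X, hX, h1, h2⟩ := h
  change X ⊆ A at hX
  change (M ↾ A).rSet X + b ≤ (M ↾ A).rSet A at h2
  rw [restrict_rSet M hX] at h1 h2
  rw [restrict_rSet M Subset.rfl] at h2
  exact ⟨X, hX, h1, h2⟩

lemma Sep.PP {M : Matroid α} (hM : M.Finite) {A : Set α} (h : M.Sep A) {X Y : Set α} {a b : ℕ}
    (hX : X ⊆ A) (hY : Y ⊆ M.E \ A) (h1 : M.rSet X + M.rSet Y + a ≤ X.ncard + Y.ncard)
    (h2 : M.rSet X + M.rSet Y + b ≤ M.rSet A + M.rSet (M.E \ A)) : M.PP a b := by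
  have hs : X ∪ Y ⊆ M.E := union_subset (hX.trans h.1) (hY.trans sdiff_subset)
  have e1 : (X ∪ Y) ∩ A = X := by
    ext x; constructor
    · rintro ⟨h | h, h'⟩
      · exact h
      · exact absurd h' (hY h).2
    · intro hx; exact ⟨Or.inl hx, hX hx⟩
  have e2 : (X ∪ Y) \ A = Y := by
    ext x; constructor
    · rintro ⟨h | h, h'⟩
      · exact absurd (hX h) h'
      · exact h
    · intro hx; exact ⟨Or.inr hx, (hY hx).2⟩
  have r1 := Sep.rSet hM h hs
  have r2 := Sep.rSet hM h (Subset.refl M.E)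
  have c1 := ncard_split M hM A hs
  rw [e1, e2] at r1 c1
  rw [inter_eq_self_of_subset_right h.1] at r2
  exact ⟨X ∪ Y, hs, by omega, by omega⟩

lemma rSet_empty (M : Matroid α) (hM : M.Finite) : M.rSet ∅ = 0 := by
  have := rSet_le_ncard M hM (empty_subset M.E)
  simpa using this

lemma restrict_fin (M : Matroid α) (hM : M.Finite) {A : Set α} (hA : A ⊆ M.E) :
    (M ↾ A).Finite := ⟨hM.ground_finite.subset hA⟩

lemma U12_indep (K : Set (Fin 2)) : U12.Indep K ↔ K.Subsingleton := by
  rw [U12, comap_indep_iff]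
  constructor
  · rintro ⟨-, h⟩ x hx y hy
    exact h hx hy rfl
  · intro h
    exact ⟨by simp, fun x hx y hy _ => h hx hy⟩

lemma fin_matroid {k : ℕ} (L : Matroid (Fin k)) : L.Finite := ⟨Set.toFinite _⟩

lemma loop_case (M : Matroid α) (hM : M.Finite) (hP : ¬ M.PP 2 2) {e : α} (he : e ∈ M.E)
    (hl : ¬ M.Indep {e}) : ∃ A : Set α, (M ↾ A).Finite ∧ (M ↾ A).PavingM ∧
      M.IsoTo ((M ↾ A).sum (loopyOn (univ : Set (Fin 1)))) := by
  have hEA : M.E \ (M.E \ {e}) = {e} := by simp [he]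
  have hS : M.Sep (M.E \ {e}) := by
    refine ⟨sdiff_subset, fun I hI h1 h2 => h1.subset fun x hx => ⟨hx, hI hx, ?_⟩⟩
    rintro rfl
    exact hl (h2.subset (by rintro y rfl; exact ⟨hx, fun h => h.2 rfl⟩))
  have hr : M.rSet {e} = 0 := by
    by_contra h
    exact hl (indep_of_rSet M hM (by simpa using he) (by rw [ncard_singleton]; omega))
  refine ⟨M.E \ {e}, restrict_fin M hM sdiff_subset, ?_, ?_⟩
  · rw [paving_iff _ (restrict_fin M hM sdiff_subset)]
    intro h
    obtain ⟨X, hX, h1, h2⟩ := restrict_PP M h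
    refine hP (Sep.PP hM hS hX (Y := {e}) hEA.ge ?_ ?_)
    · rw [hr, ncard_singleton]; omega
    · rw [hr]; omega
  · apply iso_sum M hS _ (fun _ => 0)
    · rw [hEA]; simp
    · rw [hEA]; ext x; simp [Subsingleton.elim x 0]
    · rw [hEA]
      intro J hJ
      rw [loopyOn_indep_iff, image_eq_empty]
      constructor
      · intro h
        rcases subset_singleton_iff_eq.1 hJ with rfl | rfl
        · rfl
        · exact absurd h hl
      · rintro rfl; exact M.empty_indep

lemma coloop_case (M : Matroid α) (hM : M.Finite) (hP : ¬ M.PP 2 2) {e : α} (he : e ∈ M.E)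
    (hl : ∀ I, M.Indep I → M.Indep (insert e I)) : ∃ N : Matroid α, N.Finite ∧ N.PavingM ∧
      M.IsoTo (N✶.sum (freeOn (univ : Set (Fin 1)))) := by
  have hEA : M.E \ (M.E \ {e}) = {e} := by simp [he]
  have hS : M.Sep (M.E \ {e}) := by
    refine ⟨sdiff_subset, fun I hI h1 h2 => (hl _ h1).subset fun x hx => ?_⟩
    by_cases hxe : x = e
    · exact Or.inl hxe
    · exact Or.inr ⟨hx, hI hx, hxe⟩
  have hei : M.Indep {e} := by simpa using hl ∅ M.empty_indep
  have hr : 1 ≤ M.rSet {e} := by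
    simpa using indep_le_rSet M hM hei Subset.rfl (by simpa using he)
  have hf := restrict_fin M hM (A := M.E \ {e}) sdiff_subset
  refine ⟨(M ↾ (M.E \ {e}))✶, ⟨hf.ground_finite⟩, ?_, ?_⟩
  · rw [paving_dual_iff _ hf]
    intro h
    obtain ⟨X, hX, h1, h2⟩ := restrict_PP M h
    refine hP (Sep.PP hM hS hX (Y := ∅) (empty_subset _) ?_ ?_)
    · rw [rSet_empty M hM, ncard_empty]; omega
    · rw [rSet_empty M hM, hEA]; omega
  · rw [dual_dual]
    apply iso_sum M hS _ (fun _ => 0)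
    · rw [hEA]; simp
    · rw [hEA]; ext x; simp [Subsingleton.elim x 0]
    · rw [hEA]
      intro J hJ
      simp [hei.subset hJ]

lemma U12_case (M : Matroid α) (hM : M.Finite) (hP : ¬ M.PP 2 2) {A : Set α} (hS : M.Sep A)
    (hr : M.rSet (M.E \ A) = 1) (hc : (M.E \ A).ncard = 2) (hl : ∀ e ∈ M.E, M.Indep {e}) :
    (M ↾ A).Finite ∧ (M ↾ A).PavingM ∧ (M ↾ A)✶.PavingM ∧ M.IsoTo ((M ↾ A).sum U12) := by
  have hf := restrict_fin M hM hS.1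
  refine ⟨hf, ?_, ?_, ?_⟩
  · rw [paving_iff _ hf]
    intro h
    obtain ⟨X, hX, h1, h2⟩ := restrict_PP M h
    exact hP (Sep.PP hM hS hX (Y := M.E \ A) Subset.rfl (by omega) (by omega))
  · rw [paving_dual_iff _ hf]
    intro h
    obtain ⟨X, hX, h1, h2⟩ := restrict_PP M h
    refine hP (Sep.PP hM hS hX (Y := ∅) (empty_subset _) ?_ ?_)
    · rw [rSet_empty M hM, ncard_empty]; omega
    · rw [rSet_empty M hM]; omega
  · classical
    obtain ⟨u, v, huv, hE⟩ := ncard_eq_two.1 hc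
    let g : α → Fin 2 := fun x => if x = u then 0 else 1
    have gu : g u = 0 := by simp [g]
    have gv : g v = 1 := by simp [g, huv.symm]
    have hinj : InjOn g (M.E \ A) := by
      rw [hE]
      rintro x (rfl | rfl) y (rfl | rfl) h
      · rfl
      · rw [gu, gv] at h; simp at h
      · rw [gu, gv] at h; simp at h
      · rfl
    apply iso_sum M hS _ g hinj
    · rw [hE, image_pair, gu, gv]
      change _ = univ
      ext i; revert i; decide
    · intro J hJ
      rw [U12_indep]
      constructor
      · rintro hJi _ ⟨x, hx, rfl⟩ _ ⟨y, hy, rfl⟩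
        have h1 := indep_le_rSet M hM hJi hJ sdiff_subset
        rw [hr, ncard_le_one (hM.ground_finite.subset (hJ.trans sdiff_subset))] at h1
        rw [h1 x hx y hy]
      · intro h
        have hJs : J.Subsingleton := fun x hx y hy =>
          hinj (hJ hx) (hJ hy) (h (mem_image_of_mem g hx) (mem_image_of_mem g hy))
        rcases hJs.eq_empty_or_singleton with rfl | ⟨x, rfl⟩
        · exact M.empty_indep
        · exact hl x (hJ rfl).1

lemma coloop_of_rank (M : Matroid α) (hM : M.Finite) {x : α}
    (h : M.rSet (M.E \ {x}) < M.rSet M.E) : ∀ I, M.Indep I → M.Indep (insert x I) := by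
  intro I hI
  obtain ⟨J, hJ, hIJ⟩ := (hI.subset (sdiff_subset (t := {x}))).subset_isBasis_of_subset
    (sdiff_subset_sdiff_left hI.subset_ground)
  obtain ⟨B, hB, hJB⟩ := hJ.indep.exists_isBase_superset
  have hx : x ∈ B := by
    by_contra hx
    have h1 := indep_le_rSet M hM hB.indep
      (X := M.E \ {x}) (fun y hy => ⟨hB.subset_ground hy, fun h => hx (h ▸ hy)⟩) sdiff_subset
    rw [rSet_of_basis M hM hB.isBasis_ground] at h
    omega
  refine hB.indep.subset (insert_subset hx fun y hy => ?_)
  by_cases hyx : y = x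
  · exact hyx ▸ hx
  · exact hJB (hIJ ⟨hy, hyx⟩)

lemma nullity_mono (M : Matroid α) (hM : M.Finite) {X Y : Set α} (h : X ⊆ Y) (hY : Y ⊆ M.E) :
    M.rSet Y + X.ncard ≤ M.rSet X + Y.ncard := by
  obtain ⟨I, hI⟩ := M.exists_isBasis X (h.trans hY)
  obtain ⟨J, hJ, hIJ⟩ := hI.indep.subset_isBasis_of_subset (hI.subset.trans h)
  rw [rSet_of_basis M hM hI, rSet_of_basis M hM hJ]
  have hYf := hM.ground_finite.subset hY
  have hJX : J ∩ X ⊆ I := fun x hx =>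
    hI.mem_of_insert_indep hx.2 (hJ.indep.subset (insert_subset hx.1 hIJ))
  have c1 := ncard_le_ncard hJX (hYf.subset (hI.subset.trans h))
  have c2 := ncard_split M hM X (hJ.subset.trans hY)
  have c3 := ncard_split M hM X hY
  rw [inter_eq_self_of_subset_right h] at c3
  have c4 := ncard_le_ncard (sdiff_subset_sdiff_left (t := X) hJ.subset) (hYf.subset sdiff_subset)
  omega

lemma final_case (M : Matroid α) (hM : M.Finite) (hP : ¬ M.PP 2 2) {A : Set α} (hS : M.Sep A)
    (hA : A.Nonempty) (hA' : (M.E \ A).Nonempty) (hl : ∀ e ∈ M.E, M.Indep {e})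
    (hcl : ∀ e ∈ M.E, ¬ ∀ I, M.Indep I → M.Indep (insert e I))
    (h1 : ¬ (M.rSet (M.E \ A) = 1 ∧ (M.E \ A).ncard = 2))
    (h2 : ¬ (M.rSet A = 1 ∧ A.ncard = 2)) : M.PavingM ∨ M✶.PavingM := by
  have rpos : ∀ X ⊆ M.E, X.Nonempty → 1 ≤ M.rSet X := by
    rintro X hX ⟨x, hx⟩
    simpa using indep_le_rSet M hM (hl x (hX hx)) (singleton_subset_iff.2 hx) hX
  have npos : ∀ X, M.Sep X → X.Nonempty → M.rSet X + 1 ≤ X.ncard := by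
    rintro X hX ⟨x, hx⟩
    by_contra hcon
    have hXi := indep_of_rSet M hM hX.1 (by omega)
    refine hcl x (hX.1 hx) fun I hI => hX.2 _ (insert_subset (hX.1 hx) hI.subset_ground)
      (hXi.subset inter_subset_right) (hI.subset ?_)
    rintro y ⟨rfl | hy, hyX⟩
    · exact absurd hx hyX
    · exact hy
  have a1 := rpos A hS.1 hA
  have a2 := rpos _ sdiff_subset hA'
  have a3 := npos A hS hA
  have a4 := npos _ hS.compl hA'
  have r := Sep.rSet hM hS (Subset.refl M.E)
  have c := ncard_split M hM A (Subset.refl M.E)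
  rw [inter_eq_self_of_subset_right hS.1] at r c
  have b1 : ¬ (M.rSet A + 2 ≤ A.ncard ∧ 2 ≤ M.rSet (M.E \ A)) := by
    rintro ⟨p, q⟩
    refine hP (Sep.PP hM hS (X := A) (Y := ∅) Subset.rfl (empty_subset _) ?_ ?_)
    · rw [rSet_empty M hM, ncard_empty]; omega
    · rw [rSet_empty M hM]; omega
  have b2 : ¬ (M.rSet (M.E \ A) + 2 ≤ (M.E \ A).ncard ∧ 2 ≤ M.rSet A) := by
    rintro ⟨p, q⟩
    refine hP (Sep.PP hM hS (X := ∅) (Y := M.E \ A) (empty_subset _) Subset.rfl ?_ ?_)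
    · rw [rSet_empty M hM, ncard_empty]; omega
    · rw [rSet_empty M hM]; omega
  have hcase : M.rSet M.E = 2 ∨ M.E.ncard = M.rSet M.E + 2 := by omega
  rcases hcase with h | h
  · left
    rw [paving_iff M hM]
    rintro ⟨X, hX, p, q⟩
    have hne : X.Nonempty := by
      rw [nonempty_iff_ne_empty]; rintro rfl; rw [ncard_empty] at p; omega
    have := rpos X hX hne
    omega
  · right
    rw [paving_dual_iff M hM]
    rintro ⟨X, hX, p, q⟩
    obtain ⟨z, hz, hzX⟩ : ∃ z ∈ M.E, z ∉ X := by
      by_contra hcon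
      push Not at hcon
      obtain rfl := Subset.antisymm hX hcon
      omega
    refine hcl z hz (coloop_of_rank M hM ?_)
    have m := nullity_mono M hM (X := X) (Y := M.E \ {z})
      (fun y hy => ⟨hX hy, fun h => hzX (h ▸ hy)⟩) sdiff_subset
    have c2 := ncard_compl M hM (X := {z}) (by simpa using hz)
    rw [ncard_singleton] at c2
    omega

universe u

/-- a disconnected finite matroid `M` is `(2,2)`-uniform iff
(i) `M` or `M✶` is paving; or (ii) `M ≅ Mp ⊕ U₀,₁` or `M ≅ Mp✶ ⊕ U₁,₁` for a paving
matroid `Mp`; or (iii) `M ≅ Mp ⊕ U₁,₂` for a sparse paving matroid `Mp`. -/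
theorem stmt18 {α : Type u} (M : Matroid α) (hfin : M.Finite) (hdis : ¬ ConnectedM M) :
    M.KLUniform 2 2 ↔
      ((M.PavingM ∨ M✶.PavingM) ∨
        (∃ (β : Type u) (Mp : Matroid β), Mp.Finite ∧ Mp.PavingM ∧
          (M.IsoTo (Mp.sum (loopyOn (univ : Set (Fin 1)))) ∨
            M.IsoTo ((Mp✶).sum (freeOn (univ : Set (Fin 1)))))) ∨
        (∃ (β : Type u) (Mp : Matroid β), Mp.Finite ∧ Mp.PavingM ∧ Mp✶.PavingM ∧
          M.IsoTo (Mp.sum U12))) := by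
  rw [KL_iff M hfin]
  constructor
  · intro hP
    by_cases hE : M.E = ∅
    · left; left
      rw [paving_iff M hfin]
      rintro ⟨X, hX, h1, -⟩
      rw [hE, subset_empty_iff] at hX
      subst hX
      rw [ncard_empty] at h1
      omega
    by_cases hl : ∀ e ∈ M.E, M.Indep {e}
    swap
    · push Not at hl
      obtain ⟨e, he, hl⟩ := hl
      obtain ⟨A, h1, h2, h3⟩ := loop_case M hfin hP he hl
      exact Or.inr (Or.inl ⟨α, M ↾ A, h1, h2, Or.inl h3⟩)
    by_cases hcl : ∀ e ∈ M.E, ¬ ∀ I, M.Indep I → M.Indep (insert e I)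
    swap
    · push Not at hcl
      obtain ⟨e, he, hl⟩ := hcl
      obtain ⟨N, h1, h2, h3⟩ := coloop_case M hfin hP he hl
      exact Or.inr (Or.inl ⟨α, N, h1, h2, Or.inr h3⟩)
    obtain ⟨x, hx, y, hy, hxy, hC⟩ : ∃ x ∈ M.E, ∃ y ∈ M.E, x ≠ y ∧
        ¬ ∃ C, M.CircuitM C ∧ x ∈ C ∧ y ∈ C := by
      by_contra hcon
      refine hdis ⟨nonempty_iff_ne_empty.2 hE, fun x hx y hy hxy => ?_⟩
      by_contra hno
      exact hcon ⟨x, hx, y, hy, hxy, hno⟩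
    obtain ⟨A, hS, hxA, hyA⟩ := exists_sep M hfin hx hxy hC
    by_cases c1 : M.rSet (M.E \ A) = 1 ∧ (M.E \ A).ncard = 2
    · exact Or.inr (Or.inr ⟨α, M ↾ A, U12_case M hfin hP hS c1.1 c1.2 hl⟩)
    by_cases c2 : M.rSet A = 1 ∧ A.ncard = 2
    · have hAA : M.E \ (M.E \ A) = A := sdiff_sdiff_cancel_left hS.1
      exact Or.inr (Or.inr ⟨α, M ↾ (M.E \ A), U12_case M hfin hP hS.compl
        (by rw [hAA]; exact c2.1) (by rw [hAA]; exact c2.2) hl⟩)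
    exact Or.inl (final_case M hfin hP hS ⟨x, hxA⟩ ⟨y, hy, hyA⟩ hl hcl c1 c2)
  · rintro ((h | h) | ⟨β, Mp, hf, hp, h | h⟩ | ⟨β, Mp, hf, hp, hp', h⟩) hP
    · rw [paving_iff M hfin] at h
      obtain ⟨X, hX, h1, h2⟩ := hP
      exact h ⟨X, hX, by omega, by omega⟩
    · rw [paving_dual_iff M hfin] at h
      obtain ⟨X, hX, h1, h2⟩ := hP
      exact h ⟨X, hX, by omega, by omega⟩
    · rw [paving_iff Mp hf] at hp
      obtain ⟨X, hX, Z, hZ, h1, h2⟩ := sum_PP _ _ hf (fin_matroid _) (iso_PP _ _ h hP)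
      have hL := fin_matroid (loopyOn (univ : Set (Fin 1)))
      have r1 : (loopyOn (univ : Set (Fin 1))).rSet Z = 0 := by
        rw [rSet_eq_toNat _ hL _ hZ, eRk_loopyOn]; rfl
      have r2 : (loopyOn (univ : Set (Fin 1))).rSet (loopyOn (univ : Set (Fin 1))).E = 0 := by
        rw [rSet_eq_toNat _ hL _ Subset.rfl, eRk_loopyOn]; rfl
      have c : Z.ncard ≤ 1 := by simpa using ncard_le_card Z
      exact hp ⟨X, hX, by omega, by omega⟩
    · have hf' : Mp✶.Finite := ⟨hf.ground_finite⟩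
      rw [paving_iff Mp hf, ← PP_dual Mp hf] at hp
      obtain ⟨X, hX, Z, hZ, h1, h2⟩ := sum_PP _ _ hf' (fin_matroid _) (iso_PP _ _ h hP)
      have hL := fin_matroid (freeOn (univ : Set (Fin 1)))
      have r1 : (freeOn (univ : Set (Fin 1))).rSet Z = Z.ncard :=
        rSet_of_basis _ hL (freeOn_indep (subset_univ Z)).isBasis_self
      have r2 : (freeOn (univ : Set (Fin 1))).rSet (freeOn (univ : Set (Fin 1))).E ≤ 1 := by
        refine (rSet_le_ncard _ hL Subset.rfl).trans ?_
        simpa using ncard_le_card (freeOn (univ : Set (Fin 1))).E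
      exact hp ⟨X, hX, by omega, by omega⟩
    · rw [paving_iff Mp hf] at hp
      rw [paving_dual_iff Mp hf] at hp'
      obtain ⟨X, hX, Z, hZ, h1, h2⟩ := sum_PP _ _ hf (fin_matroid _) (iso_PP _ _ h hP)
      have hL := fin_matroid U12
      have r2 : U12.rSet U12.E ≤ 1 := by
        obtain ⟨I, hI⟩ := U12.exists_isBasis U12.E
        rw [rSet_of_basis _ hL hI]
        have := (U12_indep I).1 hI.indep
        exact ncard_le_one_iff_subsingleton.2 this
      have c : Z.ncard ≤ 2 := by simpa using ncard_le_card Z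
      have r1 : Z.ncard = 0 ∨ 1 ≤ U12.rSet Z := by
        rcases Z.eq_empty_or_nonempty with rfl | ⟨z, hz⟩
        · left; simp
        · right
          simpa using indep_le_rSet U12 hL ((U12_indep {z}).2 subsingleton_singleton)
            (singleton_subset_iff.2 hz) hZ
      by_cases hc : X.ncard ≤ Mp.rSet X + 1
      · exact hp ⟨X, hX, by omega, by omega⟩
      · exact hp' ⟨X, hX, by omega, by omega⟩

end Matroid
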